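/- Assume k is real with k > 0, L > 0, s ≥ 1, and that 1 − e^{i(kL−β)} ≠ 0 and 1 − e^{i(kL+β)} ≠ 0. Then the function h : ℝ → ℂ satisfies h(t) = O(t^{−1/2}) as t → 0 from the right, i.e. h is big-O (with respect to the filter nhdsWithin 0 (Ioi 0) on ℝ) of the function t ↦ t^{−1/2}. -/

import Mathlib

open Complex Filter Asymptotics MeasureTheory

/-- The branch function `R(ξ) = (ξ² - k²)^{1/2}` with the principal complex square root. -/
noncomputable def schR (k ξ : ℂ) : ℂ := (ξ ^ 2 - k ^ 2) ^ ((1 : ℂ) / 2)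

/-- The function `f_n` appearing in the integral representation of the Schlömilch series. -/
noncomputable def schF (k β : ℂ) (L : ℝ) (s n : ℤ) (ξ : ℂ) : ℂ :=
  Complex.exp ((s : ℂ) * (-Complex.I * β - schR k ξ * L)) * (ξ - schR k ξ) ^ n /
      (schR k ξ * (1 - Complex.exp (-Complex.I * β - schR k ξ * L))) +
    Complex.exp ((s : ℂ) * (Complex.I * β - schR k ξ * L)) * (ξ + schR k ξ) ^ n /
      (schR k ξ * (1 - Complex.exp (Complex.I * β - schR k ξ * L)))

/-- The steepest-descent path `Q(t) = (t² - 2ikt)^{1/2}` (principal square root). -/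
noncomputable def schQ (k : ℂ) (t : ℝ) : ℂ :=
  ((t : ℂ) ^ 2 - 2 * Complex.I * k * t) ^ ((1 : ℂ) / 2)

/-- The integrand `h(t) = (f_n(Q(t)) + f_n(-Q(t))) (t - ik)/Q(t)` of the integral
representation of the Schlömilch lattice sum. -/
noncomputable def schH (k β : ℂ) (L : ℝ) (s n : ℤ) (t : ℝ) : ℂ :=
  (schF k β L s n (schQ k t) + schF k β L s n (-schQ k t)) *
    ((t : ℂ) - Complex.I * k) / schQ k t

lemma aux_Q_sq (k : ℂ) (t : ℝ) : schQ k t ^ 2 = (t : ℂ) ^ 2 - 2 * Complex.I * k * t := by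
  have h := Complex.cpow_nat_inv_pow ((t : ℂ) ^ 2 - 2 * Complex.I * k * t) (n := 2) two_ne_zero
  rw [schQ, one_div]
  exact_mod_cast h

lemma aux_R (k t : ℝ) (ht : 0 < t) (ξ : ℂ)
    (hξ : ξ ^ 2 = (t : ℂ) ^ 2 - 2 * Complex.I * k * t) :
    schR k ξ = (t : ℂ) - Complex.I * k := by
  have h : ξ ^ 2 - (k : ℂ) ^ 2 = ((t : ℂ) - Complex.I * k) ^ 2 := by
    rw [hξ]
    linear_combination (-(k : ℂ) ^ 2) * Complex.I_sq
  rw [schR, h, one_div]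
  exact Complex.sq_cpow_two_inv (by simpa using ht)

lemma aux_Q_tendsto (k : ℂ) :
    Tendsto (fun t : ℝ => schQ k t) (nhdsWithin (0 : ℝ) (Set.Ioi 0)) (nhds 0) := by
  have h1 : Tendsto (fun t : ℝ => (t : ℂ) ^ 2 - 2 * Complex.I * k * t) (nhds 0) (nhds 0) := by
    have : Continuous (fun t : ℝ => (t : ℂ) ^ 2 - 2 * Complex.I * k * t) := by fun_prop
    simpa using this.tendsto 0
  have h2 : ContinuousAt (fun x : ℂ => x ^ ((1 : ℂ) / 2)) 0 :=
    Complex.continuousAt_cpow_const_of_re_pos (Or.inl (by simp)) (by norm_num)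
  have h3 : Tendsto (fun x : ℂ => x ^ ((1 : ℂ) / 2)) (nhds 0) (nhds 0) := by
    simpa [ContinuousAt] using h2
  exact (h3.comp h1).mono_left nhdsWithin_le_nhds

lemma aux_F (k : ℝ) (β : ℂ) (L : ℝ) (s n : ℤ) (hk : 0 < k)
    (hden₁ : 1 - Complex.exp (Complex.I * ((k : ℂ) * L - β)) ≠ 0)
    (hden₂ : 1 - Complex.exp (Complex.I * ((k : ℂ) * L + β)) ≠ 0)
    (q : ℝ → ℂ) (hq : Tendsto q (nhdsWithin (0 : ℝ) (Set.Ioi 0)) (nhds 0))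
    (hq2 : ∀ t, q t ^ 2 = (t : ℂ) ^ 2 - 2 * Complex.I * k * t) :
    (fun t : ℝ => schF k β L s n (q t))
      =O[nhdsWithin (0 : ℝ) (Set.Ioi 0)] fun _ : ℝ => (1 : ℝ) := by
  set r₀ : ℂ := -(Complex.I * k) with hr₀
  have hr0 : r₀ ≠ 0 := by simp [hr₀, hk.ne']
  have hR : Tendsto (fun t => schR k (q t)) (nhdsWithin (0 : ℝ) (Set.Ioi 0)) (nhds r₀) := by
    have h1 : Tendsto (fun t : ℝ => (t : ℂ) - Complex.I * k) (nhdsWithin (0 : ℝ) (Set.Ioi 0))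
        (nhds r₀) := by
      have : Continuous (fun t : ℝ => (t : ℂ) - Complex.I * k) := by fun_prop
      have h := this.tendsto 0
      simp only [Complex.ofReal_zero, zero_sub] at h
      exact h.mono_left nhdsWithin_le_nhds
    refine h1.congr' ?_
    filter_upwards [self_mem_nhdsWithin] with t ht
    exact (aux_R k t ht _ (hq2 t)).symm
  have e (σ b : ℂ) (hσ : σ = 1 ∨ σ = -1) (hd : 1 - Complex.exp (b - r₀ * L) ≠ 0) :
      Tendsto (fun t => Complex.exp ((s : ℂ) * (b - schR k (q t) * L)) *
        (q t + σ * schR k (q t)) ^ n / (schR k (q t) * (1 - Complex.exp (b - schR k (q t) * L))))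
        (nhdsWithin (0 : ℝ) (Set.Ioi 0))
        (nhds (Complex.exp ((s : ℂ) * (b - r₀ * L)) *
        (0 + σ * r₀) ^ n / (r₀ * (1 - Complex.exp (b - r₀ * L))))) := by
    have hb := (tendsto_const_nhds (x := b)).sub (hR.mul_const (L : ℂ))
    refine Tendsto.div (Tendsto.mul ?_ ?_) (hR.mul (hb.cexp.const_sub 1)) (mul_ne_zero hr0 hd)
    · exact (hb.const_mul (s : ℂ)).cexp
    · refine (hq.add (hR.const_mul σ)).zpow₀ n (Or.inl ?_)
      rcases hσ with h | h <;> simp [h, hr0]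
  have e1 := e (-1) (-Complex.I * β) (Or.inr rfl) (by
    convert hden₁ using 3; rw [hr₀]; ring)
  have e2 := e 1 (Complex.I * β) (Or.inl rfl) (by
    convert hden₂ using 3; rw [hr₀]; ring)
  refine ((e1.add e2).isBigO_one ℝ).congr_left fun t => ?_
  simp only [schF, neg_one_mul, one_mul, ← sub_eq_add_neg]

/-- The integrand of the Schlömilch-series integral representation has a weak
singularity of order `t^{-1/2}` at `t = 0` (for real `k > 0`). -/
theorem schH_isBigO_zero (k : ℝ) (β : ℂ) (L : ℝ) (s n : ℤ)
    (hk : 0 < k) (hs : 1 ≤ s) (hL : 0 < L)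
    (hden₁ : 1 - Complex.exp (Complex.I * ((k : ℂ) * L - β)) ≠ 0)
    (hden₂ : 1 - Complex.exp (Complex.I * ((k : ℂ) * L + β)) ≠ 0) :
    (fun t : ℝ => schH (k : ℂ) β L s n t)
      =O[nhdsWithin (0 : ℝ) (Set.Ioi 0)] fun t : ℝ => t ^ (-(1 / 2 : ℝ)) := by
  have h1 := aux_F k β L s n hk hden₁ hden₂ (fun t => schQ k t) (aux_Q_tendsto k)
    (fun t => aux_Q_sq k t)
  have h2 := aux_F k β L s n hk hden₁ hden₂ (fun t => -schQ k t)
    (by simpa using (aux_Q_tendsto (k : ℂ)).neg)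
    (fun t => by rw [neg_sq]; exact aux_Q_sq k t)
  have h3 : (fun t : ℝ => (t : ℂ) - Complex.I * k)
      =O[nhdsWithin (0 : ℝ) (Set.Ioi 0)] fun _ : ℝ => (1 : ℝ) := by
    have : Continuous (fun t : ℝ => (t : ℂ) - Complex.I * k) := by fun_prop
    exact ((this.tendsto 0).mono_left nhdsWithin_le_nhds).isBigO_one ℝ
  have h4 : (fun t : ℝ => (schQ k t)⁻¹)
      =O[nhdsWithin (0 : ℝ) (Set.Ioi 0)] fun t : ℝ => t ^ (-(1 / 2 : ℝ)) := by
    refine IsBigO.of_bound (Real.sqrt (2 * k))⁻¹ ?_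
    filter_upwards [self_mem_nhdsWithin] with t ht
    have ht : 0 < t := ht
    have hn : Real.sqrt (2 * k) * Real.sqrt t ≤ ‖schQ k t‖ := by
      rw [← Real.sqrt_mul (by positivity)]
      refine Real.sqrt_le_iff.mpr ⟨norm_nonneg _, ?_⟩
      rw [← norm_pow, aux_Q_sq]
      refine le_trans ?_ (Complex.abs_im_le_norm _)
      have : ((t : ℂ) ^ 2 - 2 * Complex.I * k * t).im = -(2 * k * t) := by
        simp [pow_two]
      rw [this, abs_neg]
      exact le_abs_self _
    rw [Real.rpow_neg ht.le, ← Real.sqrt_eq_rpow, norm_inv, norm_inv,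
      Real.norm_of_nonneg (Real.sqrt_nonneg t), ← mul_inv]
    exact inv_anti₀ (by positivity) hn
  have h5 := ((h1.add h2).mul h3).mul h4
  refine h5.congr (fun t => ?_) (fun t => by simp)
  simp only [schH, div_eq_mul_inv]
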